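/- Let R be a Noetherian ring of prime characteristic p and let I be an ideal generated by a regular sequence. If I is tightly closed (I = I^*), then I^n is tightly closed for all n ≥ 1. -/

import Mathlib

/-- The Frobenius power `I^[q]` of an ideal: the ideal generated by `q`-th powers of
elements of `I`. -/
def Ideal.frobeniusPower {R : Type*} [CommRing R] (I : Ideal R) (q : ℕ) : Ideal R :=
  Ideal.span ((· ^ q) '' (I : Set R))

/-- `x` belongs to the tight closure of `I` (in characteristic `p`): there is
`c ∈ R°` (not in any minimal prime) with `c * x^q ∈ I^[q]` for all large `q = p^e`. -/
def Ideal.memTightClosure {R : Type*} [CommRing R] (p : ℕ) (I : Ideal R) (x : R) : Prop :=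
  ∃ c : R, (∀ P ∈ minimalPrimes R, c ∉ P) ∧
    ∃ N : ℕ, ∀ e : ℕ, N ≤ e → c * x ^ p ^ e ∈ I.frobeniusPower (p ^ e)

/-- The tight closure `I^*` of an ideal `I`. -/
def Ideal.tightClosure {R : Type*} [CommRing R] (p : ℕ) (I : Ideal R) : Ideal R :=
  Ideal.span {x : R | I.memTightClosure p x}

open RingTheory.Sequence Function in
/-- Weak regularity of a sequence passes to extensions of modules. -/
theorem RingTheory.Sequence.IsWeaklyRegular.of_exact {R : Type*} [CommRing R] {rs : List R}
    {M₁ : Type*} {M₂ : Type*} {M₃ : Type*} [AddCommGroup M₁] [AddCommGroup M₂] [AddCommGroup M₃]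
    [Module R M₁] [Module R M₂] [Module R M₃] {f : M₁ →ₗ[R] M₂} {g : M₂ →ₗ[R] M₃}
    (hf : Injective f) (hfg : Exact f g) (hg : Surjective g)
    (h₁ : IsWeaklyRegular M₁ rs) (h₃ : IsWeaklyRegular M₃ rs) : IsWeaklyRegular M₂ rs := by
  induction rs generalizing M₁ M₂ M₃ with
  | nil => exact .nil R M₂
  | cons r rs ih =>
    rw [isWeaklyRegular_cons_iff] at h₁ h₃ ⊢
    refine ⟨isSMulRegular_of_range_eq_ker hf (LinearMap.exact_iff.mp hfg).symm h₁.1 h₃.1,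
      ih (f := QuotSMulTop.map r f) (g := QuotSMulTop.map r g) ?_ (QuotSMulTop.map_exact r hfg hg)
        (QuotSMulTop.map_surjective r hg) h₁.2 h₃.2⟩
    have h₀ : Exact (0 : M₁ →ₗ[R] M₁) f := (LinearMap.exact_zero_iff_injective M₁ f).mpr hf
    have h := QuotSMulTop.map_first_exact_on_four_term_exact_of_isSMulRegular_last h₀ hfg h₃.1
    rw [injective_iff_map_eq_zero]
    intro a ha
    obtain ⟨b, rfl⟩ := (h a).mp ha
    obtain ⟨b, rfl⟩ := Submodule.mkQ_surjective _ b
    simp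

open RingTheory.Sequence Function Pointwise in
/-- If `r` is regular on `M` and `rs` is weakly regular on `M ⧸ rM`, then `rs` is weakly regular
on `M ⧸ rᵏM`. -/
theorem RingTheory.Sequence.IsWeaklyRegular.quotSMulTop_pow {R M : Type*} [CommRing R]
    [AddCommGroup M] [Module R M] {r : R} {rs : List R} (hr : IsSMulRegular M r)
    (h : IsWeaklyRegular (QuotSMulTop r M) rs) (k : ℕ) :
    IsWeaklyRegular (QuotSMulTop (r ^ k) M) rs := by
  induction k with
  | zero =>
    have : Subsingleton (QuotSMulTop (r ^ 0) M) := by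
      simp [Submodule.Quotient.subsingleton_iff]
    exact ⟨fun _ _ => injective_of_subsingleton _⟩
  | succ k ih =>
    have hle₁ : r • (⊤ : Submodule R M) ≤
        (r ^ (k + 1) • (⊤ : Submodule R M)).comap (LinearMap.lsmul R M (r ^ k)) := by
      rintro _ ⟨x, -, rfl⟩
      exact ⟨x, trivial, by simp [pow_succ, mul_smul, smul_comm r]⟩
    have hle₂ : r ^ (k + 1) • (⊤ : Submodule R M) ≤
        (r ^ k • (⊤ : Submodule R M)).comap LinearMap.id := by
      rintro _ ⟨x, -, rfl⟩
      exact ⟨r • x, trivial, by simp [pow_succ, mul_smul, smul_comm r]⟩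
    refine .of_exact (f := Submodule.mapQ _ _ _ hle₁) (g := Submodule.mapQ _ _ _ hle₂)
      ?_ ?_ ?_ h ih
    · rw [injective_iff_map_eq_zero]
      intro a ha
      obtain ⟨a, rfl⟩ := Submodule.mkQ_surjective _ a
      simp only [Submodule.mkQ_apply, Submodule.mapQ_apply, Submodule.Quotient.mk_eq_zero] at ha ⊢
      obtain ⟨b, -, hb⟩ := ha
      refine ⟨b, trivial, hr.pow k ?_⟩
      simpa [pow_succ, mul_smul] using hb
    · intro a
      obtain ⟨a, rfl⟩ := Submodule.mkQ_surjective _ a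
      simp only [Submodule.mkQ_apply, Submodule.mapQ_apply, Submodule.Quotient.mk_eq_zero]
      constructor
      · rintro ⟨b, -, hb⟩
        exact ⟨Submodule.Quotient.mk b, congrArg Submodule.Quotient.mk hb⟩
      · rintro ⟨b, hb⟩
        obtain ⟨b, rfl⟩ := Submodule.mkQ_surjective _ b
        simp only [Submodule.mkQ_apply, Submodule.mapQ_apply, Submodule.Quotient.eq] at hb
        obtain ⟨c, -, hc⟩ := hb
        refine ⟨b - r • c, trivial, ?_⟩
        simp only [DistribSMul.toLinearMap_apply, LinearMap.lsmul_apply] at hc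
        simp [smul_sub, ← mul_smul, ← pow_succ, hc]
    · intro a
      obtain ⟨a, rfl⟩ := Submodule.mkQ_surjective _ a
      exact ⟨Submodule.Quotient.mk a, rfl⟩

open RingTheory.Sequence in
theorem RingTheory.Sequence.IsWeaklyRegular.map_pow {R M : Type*} [CommRing R]
    [AddCommGroup M] [Module R M] {rs : List R} (h : IsWeaklyRegular M rs) (k : ℕ) :
    IsWeaklyRegular M (rs.map (· ^ k)) := by
  induction rs generalizing M with
  | nil => exact .nil R M
  | cons r rs ih =>
    rw [isWeaklyRegular_cons_iff] at h
    exact .cons (h.1.pow k) (.quotSMulTop_pow h.1 (ih h.2) k)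

open RingTheory.Sequence in
theorem RingTheory.Sequence.isWeaklyRegular_append_singleton_iff {R : Type*} [CommRing R]
    (rs : List R) (r : R) :
    IsWeaklyRegular R (rs ++ [r]) ↔ IsWeaklyRegular R rs ∧
      ∀ w, r * w ∈ Ideal.ofList rs → w ∈ Ideal.ofList rs := by
  rw [isWeaklyRegular_append_iff, isWeaklyRegular_singleton_iff,
    isSMulRegular_quotient_iff_mem_of_smul_mem]
  simp

theorem Ideal.sup_span_singleton_pow_succ {R : Type*} [CommRing R] (J : Ideal R) (z : R) (m : ℕ) :
    (J ⊔ span {z}) ^ (m + 1) = J ^ (m + 1) ⊔ span {z} * (J ⊔ span {z}) ^ m := by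
  induction m with
  | zero => simp
  | succ m ih =>
    refine le_antisymm ?_ (sup_le (pow_right_mono le_sup_left _) ?_)
    · conv_lhs => rw [pow_succ' _ (m + 1), sup_mul]
      refine sup_le ?_ le_sup_right
      rw [ih, mul_sup, ← pow_succ', mul_left_comm, ← ih]
      refine sup_le_sup_left (mul_mono_right ?_) _
      rw [pow_succ']
      exact mul_mono_left le_sup_left
    · rw [pow_succ' _ (m + 1)]
      exact mul_mono_left le_sup_right

/-- Membership in `K * J ^ m` of elements of `J ^ m` is detected by the maps `w ↦ c i * ψ i w`,
granted that membership in `K` is. -/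
def Ideal.DetectsMulPow {R ι : Type*} [CommRing R] (ψ : ι → R →+* R) (c : ι → R)
    (K J : Ideal R) : Prop :=
  ∀ m : ℕ, ∀ w ∈ J ^ m, (∀ i, c i * ψ i w ∈ K.map (ψ i) * J.map (ψ i) ^ m) → w ∈ K * J ^ m

theorem Ideal.detectsMulPow_bot {R ι : Type*} [CommRing R] {ψ : ι → R →+* R} {c : ι → R}
    {K : Ideal R} (hK : ∀ w, (∀ i, c i * ψ i w ∈ K.map (ψ i)) → w ∈ K) :
    DetectsMulPow ψ c K ⊥ := by
  rintro (_ | m) w hw h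
  · simpa using hK w (by simpa using h)
  · obtain rfl : w = 0 := by simpa using pow_le_self m.succ_ne_zero hw
    exact zero_mem _

theorem Ideal.DetectsMulPow.sup_span_singleton {R ι : Type*} [CommRing R] {ψ : ι → R →+* R}
    {c : ι → R} {K J : Ideal R} {z : R}
    (hK : ∀ w, (∀ i, c i * ψ i w ∈ K.map (ψ i)) → w ∈ K)
    (hJK : J ≤ K) (hzK : z ∈ K)
    (hz : ∀ i m w, ψ i z * w ∈ J.map (ψ i) ^ m → w ∈ J.map (ψ i) ^ m)
    (hJ : DetectsMulPow ψ c K J) : DetectsMulPow ψ c K (J ⊔ span {z}) := by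
  intro m
  induction m with
  | zero =>
    intro w _ h
    simpa using hK w (by simpa using h)
  | succ m ih =>
    intro w hw h
    rw [sup_span_singleton_pow_succ] at hw ⊢
    obtain ⟨g, hg, v, hv, rfl⟩ := Submodule.mem_sup.mp hw
    obtain ⟨b, hb, rfl⟩ := mem_span_singleton_mul.mp hv
    have key : ∀ i, c i * ψ i b ∈ K.map (ψ i) * (J ⊔ span {z}).map (ψ i) ^ m ∧
        c i * ψ i g ∈ K.map (ψ i) * J.map (ψ i) ^ (m + 1) := by
      intro i
      have hi := h i
      rw [map_sup, map_span, Set.image_singleton] at hi ⊢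
      rw [sup_span_singleton_pow_succ, mul_sup, mul_left_comm] at hi
      obtain ⟨a, ha, v, hv, hav⟩ := Submodule.mem_sup.mp hi
      obtain ⟨u, hu, rfl⟩ := mem_span_singleton_mul.mp hv
      have hψg : ψ i g ∈ J.map (ψ i) ^ (m + 1) := by
        rw [← Ideal.map_pow]
        exact mem_map_of_mem _ hg
      rw [_root_.map_add, _root_.map_mul] at hav
      have hd : c i * ψ i b - u ∈ J.map (ψ i) ^ (m + 1) := by
        refine hz i _ _ ?_
        have e : ψ i z * (c i * ψ i b - u) = a - c i * ψ i g := by linear_combination -hav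
        rw [e]
        exact sub_mem (mul_le_right ha) (mul_mem_left _ _ hψg)
      constructor
      · have hle : J.map (ψ i) ^ (m + 1) ≤
            K.map (ψ i) * (J.map (ψ i) ⊔ span {ψ i z}) ^ m := by
          rw [pow_succ']
          exact mul_mono (map_mono hJK) (pow_right_mono le_sup_left _)
        simpa using add_mem (hle hd) hu
      · have e : c i * ψ i g = a - ψ i z * (c i * ψ i b - u) := by linear_combination -hav
        rw [e]
        exact sub_mem ha (mul_mem_mul (mem_map_of_mem _ hzK) hd)
    have hb' := ih b hb fun i => (key i).1
    have hg' := hJ _ g hg fun i => (key i).2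
    rw [mul_sup, mul_left_comm]
    exact add_mem (mem_sup_left hg') (mem_sup_right (mul_mem_mul (mem_span_singleton_self z) hb'))

theorem Ideal.mem_pow_of_detectsMulPow_self {R : Type*} [CommRing R] {J : Ideal R} {y : R}
    (h : DetectsMulPow (fun _ : Unit => RingHom.id R) (fun _ => y) J J) (m : ℕ) (w : R)
    (hw : y * w ∈ J ^ m) : w ∈ J ^ m := by
  induction m with
  | zero => simp
  | succ m ih =>
    rw [pow_succ']
    exact h m w (ih (pow_le_pow_right m.le_succ hw)) fun _ => by
      simpa [Ideal.map_id, ← pow_succ'] using hw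

open RingTheory.Sequence in
theorem RingTheory.Sequence.IsWeaklyRegular.detectsMulPow_id {R : Type*} [CommRing R]
    {xs : List R} (h : IsWeaklyRegular R xs) {K : Ideal R} (hle : Ideal.ofList xs ≤ K) {y : R}
    (hy : ∀ w, y * w ∈ K → w ∈ K) :
    Ideal.DetectsMulPow (fun _ : Unit => RingHom.id R) (fun _ => y) K (Ideal.ofList xs) := by
  have hK : ∀ w, (∀ _ : Unit, y * RingHom.id R w ∈ K.map (RingHom.id R)) → w ∈ K :=
    fun w hw => hy w (by simpa [Ideal.map_id] using hw)
  induction xs using List.reverseRecOn generalizing K y with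
  | nil =>
    rw [Ideal.ofList_nil]
    exact Ideal.detectsMulPow_bot hK
  | append_singleton xs z ih =>
    obtain ⟨hxs, hz⟩ := (isWeaklyRegular_append_singleton_iff xs z).mp h
    rw [Ideal.ofList_append, Ideal.ofList_singleton] at hle ⊢
    have hle' := le_sup_left.trans hle
    refine (ih hxs hle' hy hK).sup_span_singleton hK hle'
      (hle (Ideal.mem_sup_right (Ideal.mem_span_singleton_self z))) fun _ => ?_
    rw [Ideal.map_id]
    exact Ideal.mem_pow_of_detectsMulPow_self
      (ih hxs le_rfl hz fun w hw => hz w (by simpa [Ideal.map_id] using hw))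

open RingTheory.Sequence in
/-- If `xs` is weakly regular and `y` is regular modulo `(xs)`, then `y` is regular modulo every
power of `(xs)`. -/
theorem RingTheory.Sequence.IsWeaklyRegular.mem_ofList_pow_of_mul_mem {R : Type*} [CommRing R]
    {xs : List R} (h : IsWeaklyRegular R xs) {y : R}
    (hy : ∀ w, y * w ∈ Ideal.ofList xs → w ∈ Ideal.ofList xs) (m : ℕ) (w : R)
    (hw : y * w ∈ Ideal.ofList xs ^ m) : w ∈ Ideal.ofList xs ^ m :=
  Ideal.mem_pow_of_detectsMulPow_self (h.detectsMulPow_id le_rfl hy) m w hw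

open RingTheory.Sequence in
theorem Ideal.detectsMulPow_ofList {R ι : Type*} [CommRing R] {ψ : ι → R →+* R}
    {c : ι → R} {K : Ideal R} {xs : List R} (h : ∀ i, IsWeaklyRegular R (xs.map (ψ i)))
    (hle : ofList xs ≤ K) (hK : ∀ w, (∀ i, c i * ψ i w ∈ K.map (ψ i)) → w ∈ K) :
    DetectsMulPow ψ c K (ofList xs) := by
  induction xs using List.reverseRecOn with
  | nil =>
    rw [ofList_nil]
    exact detectsMulPow_bot hK
  | append_singleton xs z ih =>
    simp only [List.map_append, List.map_cons, List.map_nil,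
      isWeaklyRegular_append_singleton_iff] at h
    rw [ofList_append, ofList_singleton] at hle ⊢
    have hle' := le_sup_left.trans hle
    refine (ih (fun i => (h i).1) hle').sup_span_singleton hK hle'
      (hle (mem_sup_right (mem_span_singleton_self z))) fun i => ?_
    rw [map_ofList]
    exact (h i).1.mem_ofList_pow_of_mul_mem (h i).2

theorem Ideal.memTightClosure.mono {R : Type*} [CommRing R] {p : ℕ} {I J : Ideal R} (hIJ : I ≤ J)
    {x : R} (hx : I.memTightClosure p x) : J.memTightClosure p x := by
  obtain ⟨c, hc, N, h⟩ := hx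
  exact ⟨c, hc, N, fun e he => span_mono (Set.image_mono hIJ) (h e he)⟩

theorem Ideal.le_tightClosure {R : Type*} [CommRing R] (p : ℕ) (I : Ideal R) :
    I ≤ I.tightClosure p := fun x hx =>
  subset_span ⟨1, fun _ hP => (ne_top_iff_one _).mp (IsMinimalPrime.isPrime hP).ne_top, 0,
    fun _ _ => mul_mem_left _ _ (subset_span ⟨x, hx, rfl⟩)⟩

/-- **(Watanabe.)** If `R` is a Noetherian ring of prime characteristic `p` and `I` is an
ideal generated by a regular sequence which is tightly closed, then `I^n` is tightly
closed for all `n ≥ 1`. -/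
theorem pow_tightly_closed_of_tightly_closed {R : Type*} [CommRing R] [IsNoetherianRing R]
    (p : ℕ) [Fact p.Prime] [CharP R p]
    (xs : List R) (hreg : RingTheory.Sequence.IsRegular R xs)
    (I : Ideal R) (hI : I = Ideal.ofList xs)
    (htc : Ideal.tightClosure p I = I) :
    ∀ n : ℕ, 1 ≤ n → Ideal.tightClosure p (I ^ n) = I ^ n := by
  intro n hn
  induction n, hn using Nat.le_induction with
  | base => rwa [pow_one]
  | succ n hn ih =>
    refine le_antisymm (Ideal.span_le.mpr fun x hx => ?_) (Ideal.le_tightClosure p _)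
    have hxn : x ∈ I ^ n :=
      ih.le (Ideal.subset_span (Ideal.memTightClosure.mono (Ideal.pow_le_pow_right n.le_succ) hx))
    obtain ⟨c, hc, N, h⟩ := hx
    have hdet : Ideal.DetectsMulPow (fun e => iterateFrobenius R p (N + e)) (fun _ => c) I I := by
      nth_rw 2 [hI]
      refine Ideal.detectsMulPow_ofList (fun e => hreg.toIsWeaklyRegular.map_pow (p ^ (N + e)))
        hI.ge fun w hw => htc.le (Ideal.subset_span ⟨c, hc, N, fun e he => ?_⟩)
      obtain ⟨e, rfl⟩ := Nat.exists_eq_add_of_le he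
      exact hw e
    rw [SetLike.mem_coe, pow_succ']
    refine hdet n x hxn fun e => ?_
    rw [← pow_succ', ← Ideal.map_pow]
    exact h (N + e) (Nat.le_add_right N e)
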